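/- arXiv:2510.20361 — 4 statements merged into one kernel-verified Lean document; each statement's English description precedes it below -/
import Mathlib

section
/- Let x, x̂ ∈ ℝ^n, let k ≥ 1 be an integer, 0 < ε ≤ 1, and let c ≥ 1 with ck ≤ n. Suppose a number t̂ satisfies (1/c)·‖x_{−ck}‖₂² ≤ t̂ ≤ ‖x_{−k}‖₂², and suppose |x_i − x̂_i|² ≤ (ε/(32ck))·‖x_{−ck}‖₂² for all i ∈ [n]. Then: (1) every heavy coordinate i (i.e., with |x_i|² ≥ (ε/k)·‖x_{−k}‖₂²) satisfies |x̂_i|² ≥ (ε/(2k))·t̂; and (2) every coordinate i that is not intermediate (i.e., with |x_i|² < (ε/(4ck))·‖x_{−ck}‖₂²) satisfies |x̂_i|² < (ε/(2k))·t̂. -/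
/-- `tailSq x k = ‖x_{−k}‖₂²`, the squared Euclidean norm of the vector obtained from
`x` by zeroing out the `k` entries of largest absolute value. Equivalently, it is the
minimum of `∑_{i ∉ S} x_i²` over all sets `S` of `k` coordinates. -/
noncomputable def tailSq {n : ℕ} (x : Fin n → ℝ) (k : ℕ) : ℝ :=
  sInf {t : ℝ | ∃ S : Finset (Fin n), S.card = k ∧ t = ∑ i ∈ Sᶜ, (x i) ^ 2}

/-- Recovery threshold. If `(1/c)·‖x_{−ck}‖₂² ≤ t̂ ≤ ‖x_{−k}‖₂²` and
`|x_i − x̂_i|² ≤ (ε/(32ck))·‖x_{−ck}‖₂²` for all `i`, then every heavy coordinate `i`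
satisfies `|x̂_i|² ≥ (ε/(2k))·t̂`, and every non-intermediate coordinate `i` satisfies
`|x̂_i|² < (ε/(2k))·t̂`. -/
theorem stmt_6 (n k c : ℕ) (hk : 1 ≤ k) (hc : 1 ≤ c) (hck : c * k ≤ n)
    (ε : ℝ) (hε0 : 0 < ε) (hε1 : ε ≤ 1)
    (x xh : Fin n → ℝ) (t : ℝ)
    (ht1 : tailSq x (c * k) / (c : ℝ) ≤ t) (ht2 : t ≤ tailSq x k)
    (hpt : ∀ i : Fin n, (x i - xh i) ^ 2 ≤ ε / (32 * (c : ℝ) * k) * tailSq x (c * k)) :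
    (∀ i : Fin n, ε / (k : ℝ) * tailSq x k ≤ (x i) ^ 2 →
        ε / (2 * (k : ℝ)) * t ≤ (xh i) ^ 2) ∧
    (∀ i : Fin n, (x i) ^ 2 < ε / (4 * (c : ℝ) * k) * tailSq x (c * k) →
        (xh i) ^ 2 < ε / (2 * (k : ℝ)) * t) := by
  have hk' : (0 : ℝ) < k := by exact_mod_cast hk
  have hc' : (0 : ℝ) < c := by exact_mod_cast hc
  have lower : ε / (c * k : ℝ) * tailSq x (c * k) ≤ ε / k * t :=
    calc ε / (c * k : ℝ) * tailSq x (c * k) = ε / k * (tailSq x (c * k) / c) := by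
          field_simp
      _ ≤ ε / k * t := by gcongr
  have upper : ε / k * t ≤ ε / k * tailSq x k := by gcongr
  have half : ε / (2 * (k : ℝ)) * t = ε / k * t / 2 := by field_simp
  have quarter : ε / (4 * (c : ℝ) * k) * tailSq x (c * k)
      = ε / (c * k : ℝ) * tailSq x (c * k) / 4 := by field_simp
  have error (i : Fin n) : (x i - xh i) ^ 2 ≤ ε / (c * k : ℝ) * tailSq x (c * k) / 32 :=
    (hpt i).trans_eq (by field_simp)
  rw [half, quarter]
  refine ⟨fun i hi => ?_, fun i hi => ?_⟩
  · linarith [error i, sq_nonneg (x i - xh i), sq_nonneg (x i / 2 - 2 * (x i - xh i))]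
  · linarith [error i, sq_nonneg (x i - xh i), sq_nonneg (x i + 2 * (x i - xh i))]
end

section
/- Let x ∈ ℝ^n be fixed with ‖x_{−k}‖₂ > 0, let k ≥ 1 be an integer, 0 < ε ≤ 1, n ≥ 2, and let I ⊆ [n] be a fixed finite set. Let x̂ be a random vector on a probability space such that for every i ∈ I and every integer λ ≥ 2, Pr(|x_i − x̂_i|² ≥ (ε(λ−1))/(2^{14}·k·log n)·‖x_{−k}‖₂²) ≤ exp(−10(λ−1)). For each integer λ ≥ 1 define the random set I_λ = {i ∈ I : (ε(λ−1))/(2^{14}·k·log n)·‖x_{−k}‖₂² ≤ |x_i − x̂_i|² ≤ (ελ)/(2^{14}·k·log n)·‖x_{−k}‖₂²}. Then with probability at least 0.99 it holds simultaneously for all integers λ ≥ 1 that |I_λ| ≤ |I|/2^{λ−1}. -/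
open MeasureTheory
open scoped Classical

/-- A Markov bound for the number of events of a finite family that occur; the events need not
be measurable. -/
theorem measure_card_lt_mul_card_filter_le {Ω ι : Type*} [MeasurableSpace Ω] (P : Measure Ω)
    (I : Finset ι) (A : ι → Set Ω) (a : ℕ) (p : ENNReal) (hA : ∀ i ∈ I, P (A i) ≤ p) :
    P {ω | I.card < a * (I.filter fun i => ω ∈ A i).card} ≤ a * p := by
  rcases I.eq_empty_or_nonempty with rfl | hI
  · simp
  have hcard : (I.card : ENNReal) ≠ 0 := by simpa using hI.ne_empty
  set B : ι → Set Ω := fun i => toMeasurable P (A i)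
  have hB : ∀ i, MeasurableSet (B i) := fun i => measurableSet_toMeasurable P (A i)
  set f : Ω → ENNReal := fun ω => a * ∑ i ∈ I, (B i).indicator 1 ω
  have hsum : Measurable fun ω => ∑ i ∈ I, (B i).indicator (1 : Ω → ENNReal) ω :=
    Finset.measurable_fun_sum I fun i _ => measurable_one.indicator (hB i)
  have hf : Measurable f := hsum.const_mul _
  have hsub : {ω | I.card < a * (I.filter fun i => ω ∈ A i).card} ⊆
      {ω | (I.card : ENNReal) ≤ f ω} := by
    intro ω hω
    have hle : ((I.filter fun i => ω ∈ A i).card : ENNReal) ≤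
        ∑ i ∈ I, (B i).indicator 1 ω := by
      rw [Finset.card_filter, Nat.cast_sum]
      refine Finset.sum_le_sum fun i _ => ?_
      by_cases h : ω ∈ A i
      · simp [h, B, subset_toMeasurable P (A i) h]
      · simp [h]
    calc (I.card : ENNReal) ≤ ((a * (I.filter fun i => ω ∈ A i).card : ℕ) : ENNReal) := by
          exact_mod_cast (show I.card < _ from hω).le
      _ = a * ((I.filter fun i => ω ∈ A i).card : ENNReal) := by push_cast; rfl
      _ ≤ f ω := mul_le_mul_right hle _
  have hint : ∫⁻ ω, f ω ∂P ≤ I.card * (a * p) := by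
    rw [lintegral_const_mul _ hsum,
      lintegral_finsetSum _ fun i _ => measurable_one.indicator (hB i)]
    calc (a : ENNReal) * ∑ i ∈ I, ∫⁻ ω, (B i).indicator 1 ω ∂P
        ≤ a * ∑ _i ∈ I, p := by
          gcongr with i hi
          rw [lintegral_indicator_one (hB i), measure_toMeasurable]
          exact hA i hi
      _ = I.card * (a * p) := by
          rw [Finset.sum_const, nsmul_eq_mul]; ring
  rw [← ENNReal.mul_le_mul_iff_right hcard (ENNReal.natCast_ne_top _)]
  calc _ ≤ (I.card : ENNReal) * P {ω | (I.card : ENNReal) ≤ f ω} := by gcongr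
    _ ≤ ∫⁻ ω, f ω ∂P := mul_meas_ge_le_lintegral hf _
    _ ≤ _ := hint

theorem exp_neg_ten_mul_le (m : ℕ) : Real.exp (-10 * (m : ℝ)) ≤ (1 / 1024) ^ m := by
  have h : Real.exp (-10) ≤ 1 / 1024 := by
    have h1 : (2 : ℝ) ≤ Real.exp 1 := by linarith [Real.add_one_le_exp (1 : ℝ)]
    have h2 : (2 : ℝ) ^ 10 ≤ Real.exp 10 := by
      calc (2 : ℝ) ^ 10 ≤ Real.exp 1 ^ 10 := by gcongr
        _ = Real.exp 10 := by rw [← Real.exp_nat_mul]; norm_num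
    rw [Real.exp_neg, ← one_div]
    exact one_div_le_one_div_of_le (by norm_num) (by linarith)
  rw [mul_comm, Real.exp_nat_mul]
  gcongr

/-- If the events `A i m` have probability at most `exp (-10 (m + 1))`, then with probability at
least `0.99` at most a `2 ^ (-(m + 1))` fraction of the `A i m` occurs, for all `m` at once. -/
theorem le_measure_forall_two_pow_mul_card_filter_le {Ω ι : Type*} [MeasurableSpace Ω]
    (P : Measure Ω) [IsProbabilityMeasure P] (I : Finset ι) (A : ι → ℕ → Set Ω)
    (hA : ∀ i ∈ I, ∀ m : ℕ,
      P (A i m) ≤ ENNReal.ofReal (Real.exp (-10 * ((m + 1 : ℕ) : ℝ)))) :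
    ENNReal.ofReal 0.99 ≤
      P {ω | ∀ m : ℕ, 2 ^ (m + 1) * (I.filter fun i => ω ∈ A i m).card ≤ I.card} := by
  set G := {ω | ∀ m : ℕ, 2 ^ (m + 1) * (I.filter fun i => ω ∈ A i m).card ≤ I.card}
  have hpow : ∀ m : ℕ, P {ω | I.card < 2 ^ (m + 1) * (I.filter fun i => ω ∈ A i m).card} ≤
      ENNReal.ofReal ((1 / 512) ^ (m + 1)) := by
    intro m
    refine (measure_card_lt_mul_card_filter_le P I (fun i => A i m) (2 ^ (m + 1)) _
      fun i hi => hA i hi m).trans ?_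
    rw [← ENNReal.ofReal_natCast, ← ENNReal.ofReal_mul (by positivity)]
    apply ENNReal.ofReal_le_ofReal
    calc (((2 ^ (m + 1) : ℕ) : ℝ)) * Real.exp (-10 * ((m + 1 : ℕ) : ℝ))
        ≤ ((2 ^ (m + 1) : ℕ) : ℝ) * (1 / 1024) ^ (m + 1) := by
          gcongr; exact exp_neg_ten_mul_le (m + 1)
      _ = (1 / 512) ^ (m + 1) := by
          push_cast; rw [← mul_pow]; norm_num
  have hsum : HasSum (fun m : ℕ => ((1 : ℝ) / 512) ^ (m + 1)) (1 / 511) := by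
    have h := (hasSum_geometric_of_lt_one (r := (1 : ℝ) / 512) (by norm_num)
      (by norm_num)).mul_left (1 / 512)
    have hval : (1 : ℝ) / 512 * (1 - 1 / 512)⁻¹ = 1 / 511 := by norm_num
    simpa only [pow_succ', hval] using h
  have hbad : P Gᶜ ≤ ENNReal.ofReal 0.01 := by
    have hG : Gᶜ = ⋃ m : ℕ,
        {ω | I.card < 2 ^ (m + 1) * (I.filter fun i => ω ∈ A i m).card} := by
      ext ω; simp [G]
    calc P Gᶜ ≤ ∑' m : ℕ, ENNReal.ofReal ((1 / 512) ^ (m + 1)) := by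
          rw [hG]; exact (measure_iUnion_le _).trans (ENNReal.tsum_le_tsum hpow)
      _ = ENNReal.ofReal (1 / 511) := by
          rw [← ENNReal.ofReal_tsum_of_nonneg (fun m => by positivity) hsum.summable,
            hsum.tsum_eq]
      _ ≤ ENNReal.ofReal 0.01 := ENNReal.ofReal_le_ofReal (by norm_num)
  have hone : 1 ≤ P G + ENNReal.ofReal 0.01 := by
    calc 1 = P (G ∪ Gᶜ) := by rw [Set.union_compl_self, measure_univ]
      _ ≤ P G + P Gᶜ := measure_union_le _ _
      _ ≤ _ := by gcongr
  calc ENNReal.ofReal 0.99 = 1 - ENNReal.ofReal 0.01 := by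
        rw [← ENNReal.ofReal_one, ← ENNReal.ofReal_sub _ (by norm_num)]; norm_num
    _ ≤ P G := tsub_le_iff_right.mpr hone

/-- Intermediate point estimates. Let `x̂ = X ω` be a random vector
such that for all `i ∈ I` and all integers `λ ≥ 2`,
`Pr(|x_i − x̂_i|² ≥ ε(λ−1)/(2¹⁴ k log₂ n)·‖x_{−k}‖₂²) ≤ exp(−10(λ−1))`. Then with
probability at least `0.99`, for all integers `λ ≥ 1` simultaneously the set
`I_λ = {i ∈ I : ε(λ−1)/(2¹⁴ k log₂ n)·‖x_{−k}‖₂² ≤ |x_i − x̂_i|² ≤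
ελ/(2¹⁴ k log₂ n)·‖x_{−k}‖₂²}` has at most `|I|/2^{λ−1}` elements. -/
theorem stmt_7 (n k : ℕ) (hn : 2 ≤ n) (hk : 1 ≤ k) (hkn : k ≤ n)
    (ε : ℝ) (hε0 : 0 < ε) (hε1 : ε ≤ 1)
    (x : Fin n → ℝ) (htail : 0 < tailSq x k)
    (I : Finset (Fin n))
    {Ω : Type*} [MeasurableSpace Ω] (P : Measure Ω) [IsProbabilityMeasure P]
    (X : Ω → Fin n → ℝ)
    (hconc : ∀ i ∈ I, ∀ lam : ℕ, 2 ≤ lam →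
      P {ω | ε * ((lam : ℝ) - 1) / (2 ^ 14 * (k : ℝ) * Real.logb 2 (n : ℝ)) * tailSq x k
              ≤ (x i - X ω i) ^ 2}
        ≤ ENNReal.ofReal (Real.exp (-10 * ((lam : ℝ) - 1)))) :
    ENNReal.ofReal 0.99 ≤
      P {ω | ∀ lam : ℕ, 1 ≤ lam →
        ((I.filter fun i =>
            ε * ((lam : ℝ) - 1) / (2 ^ 14 * (k : ℝ) * Real.logb 2 (n : ℝ)) * tailSq x k
                ≤ (x i - X ω i) ^ 2 ∧
            (x i - X ω i) ^ 2
                ≤ ε * (lam : ℝ) / (2 ^ 14 * (k : ℝ) * Real.logb 2 (n : ℝ)) * tailSq x k).card : ℝ)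
          ≤ (I.card : ℝ) / 2 ^ (lam - 1)} := by
  refine (le_measure_forall_two_pow_mul_card_filter_le P I
    (fun i m => {ω | ε * (((m + 2 : ℕ) : ℝ) - 1) /
      (2 ^ 14 * (k : ℝ) * Real.logb 2 (n : ℝ)) * tailSq x k ≤ (x i - X ω i) ^ 2}) ?_).trans
    (measure_mono ?_)
  · intro i hi m
    convert hconc i hi (m + 2) (by omega) using 4
    push_cast; ring
  · intro ω hω lam hlam
    obtain rfl | ⟨m, rfl⟩ : lam = 1 ∨ ∃ m, lam = m + 2 := by
      rcases lam with _ | _ | m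
      · omega
      · exact Or.inl rfl
      · exact Or.inr ⟨m, rfl⟩
    · simpa using Finset.card_filter_le I _
    · rw [le_div_iff₀ (by positivity), mul_comm]
      have hm : 2 ^ (m + 1) * (I.filter fun i => ω ∈ {ω | ε * (((m + 2 : ℕ) : ℝ) - 1) /
          (2 ^ 14 * (k : ℝ) * Real.logb 2 (n : ℝ)) * tailSq x k ≤
            (x i - X ω i) ^ 2}).card ≤ I.card := hω m
      have hsub := Finset.card_le_card (Finset.monotone_filter_right I
        (fun i _ (h : ε * (((m + 2 : ℕ) : ℝ) - 1) /
          (2 ^ 14 * (k : ℝ) * Real.logb 2 (n : ℝ)) * tailSq x k ≤ (x i - X ω i) ^ 2 ∧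
          (x i - X ω i) ^ 2 ≤ ε * ((m + 2 : ℕ) : ℝ) /
            (2 ^ 14 * (k : ℝ) * Real.logb 2 (n : ℝ)) * tailSq x k) => h.1))
      exact_mod_cast (Nat.mul_le_mul_left (2 ^ (m + 1)) hsub).trans hm
end

section
/- Let x ∈ ℝ^n with ‖x_{−k}‖₂ > 0, let k ≥ 1 be an integer, 0 < ε ≤ 1, and let c ≥ 1 be a constant. Set V = [2^{19}·c·k/ε], let H = {i ∈ [n] : |x_i|² ≥ (ε/k)·‖x_{−k}‖₂²}, L = [n] \ H, and let T ⊆ [n] be the set of the k largest coordinates of x in absolute value. For each i ∈ [n] let e_i be an independent uniformly random 3-element subset of V, and form the associated 3-uniform hypergraph G = (V, E, w) with edge set E = {e_i : i ∈ H}, edge weights w_{e_i} = |x_i|², and vertex weights w_v = Σ_{i ∈ L : v ∈ e_i} |x_i|². Let ρ = 2048 and let P = {i ∈ H : e_i is ρ-peelable in G}. Then, provided k/ε is at least a sufficiently large constant, with probability at least 0.97 it holds that ‖x_{T \ P}‖₂² ≤ 800·ε·‖x_{−k}‖₂². -/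
open scoped Classical

/-- In the (multi-)hypergraph whose edges are `e_i = es i` for indices `i` in a set `A`,
with edge weights `x_i²` and vertex weights `wv`, the index `i ∈ A` is `ρ`-free if some
vertex `v ∈ e_i` satisfies `x_i² ≥ ρ·(w_v + ∑_{j ∈ A, j ≠ i, v ∈ e_j} x_j²)`. -/
def IsFreeIdx {n : ℕ} {V : Type*} [DecidableEq V] (x : Fin n → ℝ) (es : Fin n → Finset V)
    (wv : V → ℝ) (ρ : ℝ) (A : Finset (Fin n)) (i : Fin n) : Prop :=
  ∃ v ∈ es i, ρ * (wv v + ∑ j ∈ (A.erase i).filter (fun j => v ∈ es j), (x j) ^ 2) ≤ (x i) ^ 2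

/-- A `ρ`-peeling sequence of indices: each listed index is `ρ`-free after the removal of
the previously listed ones. -/
def PeelSeqIdx {n : ℕ} {V : Type*} [DecidableEq V] (x : Fin n → ℝ) (es : Fin n → Finset V)
    (wv : V → ℝ) (ρ : ℝ) : Finset (Fin n) → List (Fin n) → Prop
  | _, [] => True
  | A, i :: L => i ∈ A ∧ IsFreeIdx x es wv ρ A i ∧ PeelSeqIdx x es wv ρ (A.erase i) L

/-- The edge `e_i` is `ρ`-peelable if some `ρ`-peeling sequence contains `i`. -/
def PeelableIdx {n : ℕ} {V : Type*} [DecidableEq V] (x : Fin n → ℝ) (es : Fin n → Finset V)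
    (wv : V → ℝ) (ρ : ℝ) (A : Finset (Fin n)) (i : Fin n) : Prop :=
  ∃ L : List (Fin n), PeelSeqIdx x es wv ρ A L ∧ i ∈ L

section Peeling

/-- Every finite set of indices can be peeled down to a remainder without free indices. -/
theorem exists_peelSeq_no_free {n : ℕ} {V : Type*} [DecidableEq V] (x : Fin n → ℝ)
    (es : Fin n → Finset V) (wv : V → ℝ) (ρ : ℝ) (A : Finset (Fin n)) :
    ∃ (L : List (Fin n)) (R : Finset (Fin n)), PeelSeqIdx x es wv ρ A L ∧ R ⊆ A ∧
      (∀ i ∈ A, i ∉ R → i ∈ L) ∧ ∀ i ∈ R, ¬ IsFreeIdx x es wv ρ R i := by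
  induction A using Finset.strongInduction with
  | H A ih =>
    by_cases h : ∃ i ∈ A, IsFreeIdx x es wv ρ A i
    · obtain ⟨i, hi, hf⟩ := h
      obtain ⟨L, R, hL, hR, hmem, hfree⟩ := ih _ (Finset.erase_ssubset hi)
      refine ⟨i :: L, R, ⟨hi, hf, hL⟩, hR.trans (Finset.erase_subset _ _), ?_, hfree⟩
      intro j hj hjR
      by_cases hji : j = i
      · simp [hji]
      · exact List.mem_cons_of_mem _ (hmem j (Finset.mem_erase.2 ⟨hji, hj⟩) hjR)
    · push Not at h
      exact ⟨[], A, trivial, subset_rfl, fun i hi hiR => absurd hi hiR, h⟩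

end Peeling

section ChainLoad

variable {ι V : Type*} [DecidableEq ι] [Fintype V] [DecidableEq V]

/-- Sum of `f (A \ {j}) a` over all ways of moving from the vertex `v` to another vertex `a`
through an edge `es j` with `j ∈ A`. -/
noncomputable def chainStep (es : ι → Finset V) (f : Finset ι → V → ℝ) (A : Finset ι) (v : V) :
    ℝ :=
  ∑ j ∈ A, ∑ a, if v ≠ a ∧ v ∈ es j ∧ a ∈ es j then f (A.erase j) a else 0

/-- Sum of `r ^ ℓ * b u` over all chains of `ℓ ≤ d` distinct edges with indices in `A` leading
from `v` to some vertex `u`. -/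
noncomputable def chainLoad (es : ι → Finset V) (b : V → ℝ) (r : ℝ) : ℕ → Finset ι → V → ℝ
  | 0 => fun _ v => b v
  | d + 1 => fun A v => b v + r * chainStep es (chainLoad es b r d) A v

theorem chainStep_nonneg {es : ι → Finset V} {f : Finset ι → V → ℝ} (hf : ∀ A v, 0 ≤ f A v)
    (A : Finset ι) (v : V) : 0 ≤ chainStep es f A v := by
  refine Finset.sum_nonneg fun j _ => Finset.sum_nonneg fun a _ => ?_
  split_ifs
  exacts [hf _ _, le_rfl]

theorem chainLoad_nonneg {es : ι → Finset V} {b : V → ℝ} {r : ℝ} (hb : ∀ v, 0 ≤ b v)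
    (hr : 0 ≤ r) (d : ℕ) (A : Finset ι) (v : V) : 0 ≤ chainLoad es b r d A v := by
  induction d generalizing A v with
  | zero => exact hb v
  | succ d ih => exact add_nonneg (hb v) (mul_nonneg hr (chainStep_nonneg ih A v))

theorem chainStep_mono {es : ι → Finset V} {f g : Finset ι → V → ℝ} (hg : ∀ A v, 0 ≤ g A v)
    (hfg : ∀ A B v, A ⊆ B → f A v ≤ g B v) {A B : Finset ι} (hAB : A ⊆ B) (v : V) :
    chainStep es f A v ≤ chainStep es g B v := by
  refine le_trans (Finset.sum_le_sum fun j _ => Finset.sum_le_sum fun a _ => ?_)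
    (Finset.sum_le_sum_of_subset_of_nonneg hAB fun j _ _ => Finset.sum_nonneg fun a _ => ?_)
  · split_ifs
    exacts [hfg _ _ _ (Finset.erase_subset_erase _ hAB), le_rfl]
  · split_ifs
    exacts [hg _ _, le_rfl]

theorem chainLoad_mono {es : ι → Finset V} {b : V → ℝ} {r : ℝ} (hb : ∀ v, 0 ≤ b v) (hr : 0 ≤ r)
    {d e : ℕ} (hde : d ≤ e) {A B : Finset ι} (hAB : A ⊆ B) (v : V) :
    chainLoad es b r d A v ≤ chainLoad es b r e B v := by
  induction d generalizing e A B v with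
  | zero =>
    cases e with
    | zero => exact le_rfl
    | succ e =>
      exact le_add_of_nonneg_right
        (mul_nonneg hr (chainStep_nonneg (chainLoad_nonneg hb hr e) B v))
  | succ d ih =>
    cases e with
    | zero => omega
    | succ e =>
      exact add_le_add_right (mul_le_mul_of_nonneg_left (chainStep_mono (chainLoad_nonneg hb hr e)
        (fun A B v h => ih (by omega) h v) hAB v) hr) _

/-- A single edge contributes its term to `chainStep`. -/
theorem le_chainStep {es : ι → Finset V} {f : Finset ι → V → ℝ} (hf : ∀ A v, 0 ≤ f A v)
    {A : Finset ι} {j : ι} (hj : j ∈ A) {v a : V} (hva : v ≠ a) (hv : v ∈ es j) (ha : a ∈ es j) :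
    f (A.erase j) a ≤ chainStep es f A v := by
  have h0 : ∀ j a, 0 ≤ if v ≠ a ∧ v ∈ es j ∧ a ∈ es j then f (A.erase j) a else 0 := by
    intro j a
    split_ifs
    exacts [hf _ _, le_rfl]
  refine le_trans ?_ (Finset.single_le_sum (fun j _ => Finset.sum_nonneg fun a _ => h0 j a) hj)
  refine le_trans ?_ (Finset.single_le_sum (fun a _ => h0 j a) (Finset.mem_univ a))
  rw [if_pos ⟨hva, hv, ha⟩]

theorem chainStep_congr {es es' : ι → Finset V} {f f' : Finset ι → V → ℝ} {A : Finset ι}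
    (hes : ∀ j ∈ A, es j = es' j) (hf : ∀ j ∈ A, ∀ a, f (A.erase j) a = f' (A.erase j) a) (v : V) :
    chainStep es f A v = chainStep es' f' A v := by
  refine Finset.sum_congr rfl fun j hj => Finset.sum_congr rfl fun a _ => ?_
  rw [hes j hj, hf j hj]

theorem chainLoad_congr {es es' : ι → Finset V} (b : V → ℝ) (r : ℝ) (d : ℕ) {A : Finset ι}
    (hes : ∀ j ∈ A, es j = es' j) (v : V) :
    chainLoad es b r d A v = chainLoad es' b r d A v := by
  induction d generalizing A v with
  | zero => rfl
  | succ d ih =>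
    simp only [chainLoad]
    rw [chainStep_congr hes fun j _ a => ih (fun i hi => hes i (Finset.mem_of_mem_erase hi)) a]

theorem chainLoad_update {σ : Type*} {e : σ → Finset V} {b : (ι → σ) → V → ℝ} (r : ℝ) (d : ℕ)
    {A : Finset ι} {j : ι} (hj : j ∉ A) (hb : ∀ ω s, b (Function.update ω j s) = b ω)
    (ω : ι → σ) (s : σ) (v : V) :
    chainLoad (fun i => e (Function.update ω j s i)) (b (Function.update ω j s)) r d A v =
      chainLoad (fun i => e (ω i)) (b ω) r d A v := by
  rw [hb]
  refine chainLoad_congr _ _ _ (fun i hi => ?_) v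
  rw [Function.update_of_ne (ne_of_mem_of_not_mem hi hj)]

/-- The indicator of a vertex, as a base load for counting chains that end there. -/
noncomputable def endAt {V : Type*} [DecidableEq V] (u : V) : V → ℝ := fun v => if v = u then 1 else 0

theorem endAt_nonneg {V : Type*} [DecidableEq V] (u v : V) : 0 ≤ endAt u v := by
  unfold endAt
  split_ifs <;> norm_num

/-- If no chain of edges returns to the edge it starts from, then the weight of an edge of a set
without free edges is bounded by the chain load at any vertex where it leaves a chain `W`. -/
theorem weight_le_chainLoad_sdiff {es : ι → Finset V} {w : ι → ℝ} {b : V → ℝ} {ρ : ℝ}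
    {m : ℕ} {H R : Finset ι} (hb : ∀ v, 0 ≤ b v) (hρ : 0 ≤ ρ) (hm : H.card ≤ m)
    (hes : ∀ j, 2 ≤ (es j).card) (hRH : R ⊆ H)
    (hblock : ∀ i ∈ R, ∀ v ∈ es i,
      w i ≤ ρ * (b v + ∑ j ∈ (R.erase i).filter (fun j => v ∈ es j), w j))
    (hacyc : ∀ i ∈ H, ∀ u ∈ es i, ∀ v ∈ es i,
      chainStep es (chainLoad es (endAt u) 1 m) (H.erase i) v < 1)
    (d : ℕ) (W : Finset ι) (hWH : W ⊆ H) (hd : (H \ W).card ≤ d) (i : ι) (hiW : i ∈ W)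
    (hiR : i ∈ R) (v : V) (hv : v ∈ es i)
    (hW : ∀ j ∈ W, j ≠ i →
      ∃ u ∈ es j, 1 ≤ chainStep es (chainLoad es (endAt u) 1 W.card) (W.erase j) v) :
    w i ≤ ρ * chainLoad es b ρ d (H \ W) v := by
  have hnew : ∀ W ⊆ H, ∀ i v, (∀ j ∈ W, j ≠ i →
      ∃ u ∈ es j, 1 ≤ chainStep es (chainLoad es (endAt u) 1 W.card) (W.erase j) v) →
      ∀ j ∈ (R.erase i).filter (fun j => v ∈ es j), j ∈ H \ W := by
    intro W hWH i v hW j hj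
    obtain ⟨⟨hji, hjR⟩, hvj⟩ : (j ≠ i ∧ j ∈ R) ∧ v ∈ es j := by simpa using hj
    refine Finset.mem_sdiff.2 ⟨hRH hjR, fun hjW => ?_⟩
    obtain ⟨u, hu, h1⟩ := hW j hjW hji
    refine absurd (hacyc j (hRH hjR) u hu v hvj) (not_lt.2 (h1.trans ?_))
    exact chainStep_mono (chainLoad_nonneg (endAt_nonneg u) zero_le_one m)
      (fun A B v h => chainLoad_mono (endAt_nonneg u) zero_le_one
        ((Finset.card_le_card hWH).trans hm) h v) (Finset.erase_subset_erase _ hWH) v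
  induction d generalizing W i v with
  | zero =>
    refine (hblock i hiR v hv).trans (mul_le_mul_of_nonneg_left ?_ hρ)
    have hemp : H \ W = ∅ := Finset.card_eq_zero.1 (Nat.le_zero.1 hd)
    have : (R.erase i).filter (fun j => v ∈ es j) = ∅ :=
      Finset.eq_empty_of_forall_notMem fun j hj => by
        simpa [hemp] using hnew W hWH i v hW j hj
    rw [this]
    simp [chainLoad]
  | succ d ih =>
    refine (hblock i hiR v hv).trans (mul_le_mul_of_nonneg_left (add_le_add_right ?_ _) hρ)
    have hload := chainLoad_nonneg (es := es) hb hρ d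
    have hterm : ∀ j a, 0 ≤ if v ≠ a ∧ v ∈ es j ∧ a ∈ es j then
        chainLoad es b ρ d ((H \ W).erase j) a else 0 := by
      intro j a
      split_ifs
      exacts [hload _ _, le_rfl]
    rw [chainStep, Finset.mul_sum]
    refine le_trans (Finset.sum_le_sum fun j hj => ?_)
      (Finset.sum_le_sum_of_subset_of_nonneg (hnew W hWH i v hW) fun j _ _ =>
        mul_nonneg hρ (Finset.sum_nonneg fun a _ => hterm j a))
    have hjA := hnew W hWH i v hW j hj
    obtain ⟨hjH, hjW⟩ := Finset.mem_sdiff.1 hjA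
    obtain ⟨⟨hji, hjR⟩, hvj⟩ : (j ≠ i ∧ j ∈ R) ∧ v ∈ es j := by simpa using hj
    obtain ⟨a, ha, hav⟩ := Finset.exists_mem_ne (lt_of_lt_of_le one_lt_two (hes j)) v
    have hsd : H \ insert j W = (H \ W).erase j := by
      ext y; simp only [Finset.mem_sdiff, Finset.mem_insert, Finset.mem_erase]; tauto
    have hcard : (H \ insert j W).card ≤ d := by
      rw [hsd, Finset.card_erase_of_mem hjA]; omega
    have key := ih (insert j W) (Finset.insert_subset hjH hWH) hcard j (Finset.mem_insert_self _ _)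
      hjR a ha ?_
    · refine key.trans (mul_le_mul_of_nonneg_left ?_ hρ)
      rw [hsd]
      refine le_trans ?_ (Finset.single_le_sum (fun a _ => hterm j a) (Finset.mem_univ a))
      rw [if_pos ⟨hav.symm, hvj, ha⟩]
    · intro j' hj' hne
      have hj'W : j' ∈ W := (Finset.mem_insert.1 hj').resolve_left hne
      have herase : ((insert j W).erase j').erase j = W.erase j' := by
        rw [Finset.erase_right_comm, Finset.erase_insert hjW]
      have hstep : ∀ u, chainLoad es (endAt u) 1 (insert j W).card (W.erase j') v ≤
          chainStep es (chainLoad es (endAt u) 1 (insert j W).card) ((insert j W).erase j') a := by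
        intro u
        rw [← herase]
        exact le_chainStep (chainLoad_nonneg (endAt_nonneg u) zero_le_one _)
          (Finset.mem_erase.2 ⟨hne.symm, Finset.mem_insert_self _ _⟩) hav ha hvj
      by_cases hj'i : j' = i
      · refine ⟨v, hj'i ▸ hv, le_trans ?_ (hstep v)⟩
        refine le_trans ?_ (chainLoad_mono (d := 0) (endAt_nonneg v) zero_le_one (Nat.zero_le _)
          subset_rfl v)
        simp [chainLoad, endAt]
      · obtain ⟨u, hu, h1⟩ := hW j' hj'W hj'i
        refine ⟨u, hu, le_trans ?_ (hstep u)⟩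
        rw [Finset.card_insert_of_notMem hjW]
        simp only [chainLoad, one_mul]
        linarith [endAt_nonneg u v]

/-- If no chain of edges returns to the edge it starts from, then the weight of an edge of a set
without free edges is bounded by the chain load at any of its vertices. -/
theorem weight_le_chainLoad_erase {es : ι → Finset V} {w : ι → ℝ} {b : V → ℝ} {ρ : ℝ}
    {m : ℕ} {H R : Finset ι} (hb : ∀ v, 0 ≤ b v) (hρ : 0 ≤ ρ) (hm : H.card ≤ m)
    (hes : ∀ j, 2 ≤ (es j).card) (hRH : R ⊆ H)
    (hblock : ∀ i ∈ R, ∀ v ∈ es i,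
      w i ≤ ρ * (b v + ∑ j ∈ (R.erase i).filter (fun j => v ∈ es j), w j))
    (hacyc : ∀ i ∈ H, ∀ u ∈ es i, ∀ v ∈ es i,
      chainStep es (chainLoad es (endAt u) 1 m) (H.erase i) v < 1)
    {i : ι} (hiR : i ∈ R) {v : V} (hv : v ∈ es i) :
    w i ≤ ρ * chainLoad es b ρ m (H.erase i) v := by
  rw [Finset.erase_eq]
  refine weight_le_chainLoad_sdiff hb hρ hm hes hRH hblock hacyc m {i}
    (Finset.singleton_subset_iff.2 (hRH hiR)) ?_ i (Finset.mem_singleton_self i) hiR v hv ?_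
  · exact (Finset.card_le_card Finset.sdiff_subset).trans hm
  · intro j hj hji
    exact absurd (Finset.mem_singleton.1 hj) hji

/-- Number of chains of distinct edges of `H` that leave an edge of `H` and return to it. -/
noncomputable def returnCount (es : ι → Finset V) (m : ℕ) (H : Finset ι) : ℝ :=
  ∑ i ∈ H, ∑ u, ∑ v, if u ∈ es i ∧ v ∈ es i then
    chainStep es (chainLoad es (endAt u) 1 m) (H.erase i) v else 0

theorem returnCount_nonneg (es : ι → Finset V) (m : ℕ) (H : Finset ι) :
    0 ≤ returnCount es m H := by
  refine Finset.sum_nonneg fun i _ => Finset.sum_nonneg fun u _ => Finset.sum_nonneg fun v _ => ?_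
  split_ifs
  exacts [chainStep_nonneg (chainLoad_nonneg (endAt_nonneg u) zero_le_one m) _ _, le_rfl]

theorem chainStep_lt_one_of_returnCount_lt_one {es : ι → Finset V} {m : ℕ} {H : Finset ι}
    (h : returnCount es m H < 1) {i : ι} (hi : i ∈ H) {u v : V} (hu : u ∈ es i) (hv : v ∈ es i) :
    chainStep es (chainLoad es (endAt u) 1 m) (H.erase i) v < 1 := by
  refine lt_of_le_of_lt ?_ h
  have h0 : ∀ i u v, 0 ≤ if u ∈ es i ∧ v ∈ es i then
      chainStep es (chainLoad es (endAt u) 1 m) (H.erase i) v else 0 := by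
    intro i u v
    split_ifs
    exacts [chainStep_nonneg (chainLoad_nonneg (endAt_nonneg u) zero_le_one m) _ _, le_rfl]
  refine le_trans ?_ (Finset.single_le_sum (fun i _ => Finset.sum_nonneg fun u _ =>
    Finset.sum_nonneg fun v _ => h0 i u v) hi)
  refine le_trans ?_ (Finset.single_le_sum (fun u _ => Finset.sum_nonneg fun v _ => h0 i u v)
    (Finset.mem_univ u))
  refine le_trans ?_ (Finset.single_le_sum (fun v _ => h0 i u v) (Finset.mem_univ v))
  rw [if_pos ⟨hu, hv⟩]

end ChainLoad

section Independence

variable {ι σ : Type*} [Fintype ι] [DecidableEq ι] [Fintype σ]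

theorem sum_sum_update (j : ι) (h : (ι → σ) → ℝ) :
    ∑ ω, ∑ s, h (Function.update ω j s) = Fintype.card σ * ∑ ω, h ω := by
  rw [← Fintype.sum_prod_type' (f := fun (ω : ι → σ) (s : σ) => h (Function.update ω j s))]
  have hinv : Function.Involutive
      (fun q : (ι → σ) × σ => (Function.update q.1 j q.2, q.1 j)) := by
    rintro ⟨ω, s⟩
    simp
  rw [← Equiv.sum_comp hinv.toPerm]
  simp [Fintype.sum_prod_type, Finset.mul_sum]

/-- A coordinate and a function not depending on it are independent. -/
theorem card_mul_sum_coord_mul (j : ι) (g : σ → ℝ) {f : (ι → σ) → ℝ}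
    (hf : ∀ ω s, f (Function.update ω j s) = f ω) :
    Fintype.card σ * ∑ ω, g (ω j) * f ω = (∑ s, g s) * ∑ ω, f ω := by
  rw [← sum_sum_update j]
  simp [hf, ← Finset.sum_mul, Finset.mul_sum]

theorem sum_ite_coord_le [Nonempty σ] (j : ι) {p : ℝ} {P : σ → Prop} [DecidablePred P]
    (hP : ((Finset.univ.filter P).card : ℝ) ≤ p * Fintype.card σ) {f : (ι → σ) → ℝ}
    (hf0 : ∀ ω, 0 ≤ f ω) (hf : ∀ ω s, f (Function.update ω j s) = f ω) :
    ∑ ω, (if P (ω j) then f ω else 0) ≤ p * ∑ ω, f ω := by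
  have hcard : (0 : ℝ) < Fintype.card σ := by exact_mod_cast Fintype.card_pos
  refine le_of_mul_le_mul_left ?_ hcard
  have h := card_mul_sum_coord_mul j (fun s => if P s then (1 : ℝ) else 0) hf
  simp only [ite_mul, one_mul, zero_mul, Finset.sum_boole] at h
  rw [h, ← mul_assoc, mul_comm (Fintype.card σ : ℝ) p]
  exact mul_le_mul_of_nonneg_right hP (Finset.sum_nonneg fun ω _ => hf0 ω)

end Independence

section Expectation

variable {ι V σ : Type*} [Fintype ι] [DecidableEq ι] [Fintype V] [DecidableEq V] [Fintype σ]
  [Nonempty σ]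

theorem sum_chainStep_le {e : σ → Finset V} {p : ℝ}
    (hpair : ∀ v a, v ≠ a →
      ((Finset.univ.filter fun s => v ∈ e s ∧ a ∈ e s).card : ℝ) ≤ p * Fintype.card σ)
    {f : (ι → σ) → Finset ι → V → ℝ} (hf0 : ∀ ω A v, 0 ≤ f ω A v) {A : Finset ι}
    (hf : ∀ j ∈ A, ∀ ω s a, f (Function.update ω j s) (A.erase j) a = f ω (A.erase j) a) (hp : 0 ≤ p)
    (v : V) :
    ∑ ω, chainStep (fun j => e (ω j)) (f ω) A v ≤
      p * ∑ j ∈ A, ∑ ω, ∑ a, f ω (A.erase j) a := by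
  simp only [chainStep]
  rw [Finset.sum_comm, Finset.mul_sum]
  refine Finset.sum_le_sum fun j hj => ?_
  rw [Finset.sum_comm, Finset.sum_comm (s := Finset.univ (α := ι → σ)), Finset.mul_sum]
  refine Finset.sum_le_sum fun a _ => ?_
  by_cases hva : v = a
  · simpa [hva] using mul_nonneg hp (Finset.sum_nonneg fun ω _ => hf0 ω (A.erase j) a)
  · simp only [ne_eq, hva, not_false_eq_true, true_and]
    exact sum_ite_coord_le (P := fun s => v ∈ e s ∧ a ∈ e s) j (hpair v a hva)
      (fun ω => hf0 ω _ a) (fun ω s => hf j hj ω s a)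

/-- The expected total chain load is at most twice the expected total base load. -/
theorem sum_chainLoad_le {e : σ → Finset V} {p r : ℝ}
    (hpair : ∀ v a, v ≠ a →
      ((Finset.univ.filter fun s => v ∈ e s ∧ a ∈ e s).card : ℝ) ≤ p * Fintype.card σ)
    (hp : 0 ≤ p) (hr : 0 ≤ r) {H : Finset ι}
    (hsmall : r * (Fintype.card V * (p * H.card)) ≤ 1 / 2)
    {b : (ι → σ) → V → ℝ} (hb0 : ∀ ω v, 0 ≤ b ω v)
    (hb : ∀ j ∈ H, ∀ ω s, b (Function.update ω j s) = b ω) (d : ℕ) {A : Finset ι} (hA : A ⊆ H) :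
    ∑ ω : ι → σ, ∑ v, chainLoad (fun i => e (ω i)) (b ω) r d A v ≤ 2 * ∑ ω, ∑ v, b ω v := by
  have hB : 0 ≤ ∑ ω, ∑ v, b ω v := Finset.sum_nonneg fun ω _ => Finset.sum_nonneg fun v _ => hb0 ω v
  induction d generalizing A with
  | zero => simp only [chainLoad]; linarith
  | succ d ih =>
    simp only [chainLoad, Finset.sum_add_distrib, ← Finset.mul_sum]
    rw [Finset.sum_comm (f := fun (ω : ι → σ) v => chainStep (fun i => e (ω i)) _ A v)]
    have hstep : ∀ v, ∑ ω : ι → σ, chainStep (fun i => e (ω i))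
        (chainLoad (fun i => e (ω i)) (b ω) r d) A v ≤
          p * (H.card * (2 * ∑ ω, ∑ v, b ω v)) := by
      intro v
      refine (sum_chainStep_le hpair (fun ω => chainLoad_nonneg (hb0 ω) hr d) (fun j hj ω s a =>
        chainLoad_update r d (Finset.notMem_erase j A) (hb j (hA hj)) ω s a) hp v).trans ?_
      refine mul_le_mul_of_nonneg_left ?_ hp
      refine (Finset.sum_le_card_nsmul A _ _ fun j _ =>
        ih ((Finset.erase_subset _ _).trans hA)).trans ?_
      rw [nsmul_eq_mul]
      exact mul_le_mul_of_nonneg_right (by exact_mod_cast Finset.card_le_card hA) (by linarith)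
    have hsum := Finset.sum_le_card_nsmul Finset.univ _ _ fun v _ => hstep v
    rw [nsmul_eq_mul, Finset.card_univ] at hsum
    have h1 := mul_le_mul_of_nonneg_left hsum hr
    have h2 := mul_le_mul_of_nonneg_right hsmall (mul_nonneg zero_le_two hB)
    have h3 : r * ((Fintype.card V : ℝ) * (p * (H.card * (2 * ∑ ω, ∑ v, b ω v)))) =
      r * (Fintype.card V * (p * H.card)) * (2 * ∑ ω, ∑ v, b ω v) := by ring
    linarith

theorem sum_returnCount_le {e : σ → Finset V} {p : ℝ} (he : ∀ s, (e s).card = 3)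
    (hpair : ∀ v a, v ≠ a →
      ((Finset.univ.filter fun s => v ∈ e s ∧ a ∈ e s).card : ℝ) ≤ p * Fintype.card σ)
    (hp : 0 ≤ p) {H : Finset ι} (hsmall : Fintype.card V * (p * H.card) ≤ 1 / 2) (m : ℕ) :
    ∑ ω : ι → σ, returnCount (fun i => e (ω i)) m H ≤
      18 * p * H.card ^ 2 * Fintype.card (ι → σ) := by
  have hσ : (0 : ℝ) < Fintype.card σ := by exact_mod_cast Fintype.card_pos
  have hstep : ∀ i u v, ∑ ω : ι → σ, chainStep (fun i => e (ω i))
      (chainLoad (fun i => e (ω i)) (endAt u) 1 m) (H.erase i) v ≤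
        2 * p * H.card * Fintype.card (ι → σ) := by
    intro i u v
    refine (sum_chainStep_le hpair (fun ω => chainLoad_nonneg (endAt_nonneg u) zero_le_one m)
      (fun j hj ω s a => chainLoad_update (b := fun _ => endAt u) 1 m (Finset.notMem_erase j _)
        (fun _ _ => rfl) ω s a) hp v).trans ?_
    have h := Finset.sum_le_card_nsmul (H.erase i) _ _ fun j _ =>
      sum_chainLoad_le (b := fun _ : ι → σ => endAt u) hpair hp zero_le_one (by simpa using hsmall)
        (fun _ => endAt_nonneg u) (fun _ _ _ _ => rfl) m
        (A := (H.erase i).erase j) ((Finset.erase_subset _ _).trans (Finset.erase_subset _ _))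
    have hone : ∑ v, endAt u v = 1 := by simp [endAt]
    simp only [hone, Finset.sum_const, Finset.card_univ, nsmul_eq_mul, mul_one] at h
    have hc : ((H.erase i).card : ℝ) ≤ H.card := by
      exact_mod_cast Finset.card_le_card (Finset.erase_subset _ _)
    have h2 := mul_le_mul_of_nonneg_right hc
      (show (0 : ℝ) ≤ 2 * Fintype.card (ι → σ) by positivity)
    calc _ ≤ p * (H.card * (2 * Fintype.card (ι → σ))) :=
          mul_le_mul_of_nonneg_left (h.trans h2) hp
      _ = _ := by ring
  have hedge : ∀ i, ∑ ω : ι → σ, ∑ u, ∑ v, (if u ∈ e (ω i) ∧ v ∈ e (ω i) then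
      chainStep (fun i => e (ω i)) (chainLoad (fun i => e (ω i)) (endAt u) 1 m) (H.erase i) v
      else 0) ≤ 18 * p * H.card * Fintype.card (ι → σ) := by
    intro i
    rw [Finset.sum_comm]
    simp_rw [Finset.sum_comm (s := Finset.univ (α := ι → σ))]
    have hpt : ∀ u v, ∑ ω : ι → σ, (if u ∈ e (ω i) ∧ v ∈ e (ω i) then
        chainStep (fun i => e (ω i)) (chainLoad (fun i => e (ω i)) (endAt u) 1 m) (H.erase i) v
        else 0) ≤ (Finset.univ.filter fun s => u ∈ e s ∧ v ∈ e s).card / Fintype.card σ *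
          (2 * p * H.card * Fintype.card (ι → σ)) := by
      intro u v
      refine (sum_ite_coord_le (P := fun s => u ∈ e s ∧ v ∈ e s)
        (p := (Finset.univ.filter fun s => u ∈ e s ∧ v ∈ e s).card / Fintype.card σ) i
        (by rw [div_mul_cancel₀ _ hσ.ne']) (fun ω => chainStep_nonneg
          (chainLoad_nonneg (endAt_nonneg u) zero_le_one m) _ _) (fun ω s => ?_)).trans
        (mul_le_mul_of_nonneg_left (hstep i u v) (by positivity))
      refine chainStep_congr (fun j hj => ?_) (fun j hj a => ?_) v
      · rw [Function.update_of_ne (Finset.ne_of_mem_erase hj)]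
      · refine chainLoad_congr _ _ _ (fun l hl => ?_) a
        rw [Function.update_of_ne (Finset.ne_of_mem_erase (Finset.mem_of_mem_erase hl))]
    refine (Finset.sum_le_sum fun u _ => Finset.sum_le_sum fun v _ => hpt u v).trans ?_
    simp only [← Finset.sum_mul, ← Finset.sum_div]
    have hcount : ∑ u, ∑ v, ((Finset.univ.filter fun s => u ∈ e s ∧ v ∈ e s).card : ℝ) =
        9 * Fintype.card σ := by
      have hswap : ∑ u, ∑ v, ((Finset.univ.filter fun s => u ∈ e s ∧ v ∈ e s).card : ℝ) =
          ∑ s, ∑ u, ∑ v, if u ∈ e s ∧ v ∈ e s then (1 : ℝ) else 0 := by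
        simp_rw [← Finset.sum_boole]
        rw [Finset.sum_comm (s := Finset.univ (α := σ))]
        exact Finset.sum_congr rfl fun u _ => Finset.sum_comm
      have hnine : ∀ s, ∑ u, ∑ v, (if u ∈ e s ∧ v ∈ e s then (1 : ℝ) else 0) = 9 := by
        intro s
        simp [ite_and, he]
        norm_num
      rw [hswap, Finset.sum_congr rfl fun s _ => hnine s]
      simp [mul_comm]
    rw [hcount, mul_div_cancel_right₀ _ hσ.ne']
    exact le_of_eq (by ring)
  simp only [returnCount]
  rw [Finset.sum_comm]
  refine (Finset.sum_le_card_nsmul H _ _ fun i _ => hedge i).trans (le_of_eq ?_)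
  rw [nsmul_eq_mul]
  ring

/-- Expected chain load seen from a random edge. -/
theorem sum_sum_ite_chainLoad_le {e : σ → Finset V} {p q r : ℝ}
    (hpair : ∀ v a, v ≠ a →
      ((Finset.univ.filter fun s => v ∈ e s ∧ a ∈ e s).card : ℝ) ≤ p * Fintype.card σ)
    (hvert : ∀ v, ((Finset.univ.filter fun s => v ∈ e s).card : ℝ) ≤ q * Fintype.card σ)
    (hp : 0 ≤ p) (hq : 0 ≤ q) (hr : 0 ≤ r) {H : Finset ι}
    (hsmall : r * (Fintype.card V * (p * H.card)) ≤ 1 / 2)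
    {b : (ι → σ) → V → ℝ} (hb0 : ∀ ω v, 0 ≤ b ω v)
    (hb : ∀ j ∈ H, ∀ ω s, b (Function.update ω j s) = b ω) (d : ℕ) {i : ι} (hi : i ∈ H) :
    ∑ ω : ι → σ, ∑ v, (if v ∈ e (ω i) then
      chainLoad (fun j => e (ω j)) (b ω) r d (H.erase i) v else 0) ≤
      q * (2 * ∑ ω, ∑ v, b ω v) := by
  refine le_trans ?_ (mul_le_mul_of_nonneg_left (sum_chainLoad_le (A := H.erase i) hpair hp hr
    hsmall hb0 hb d (Finset.erase_subset _ _)) hq)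
  rw [Finset.sum_comm, Finset.sum_comm (s := Finset.univ (α := ι → σ)), Finset.mul_sum]
  exact Finset.sum_le_sum fun v _ => sum_ite_coord_le (P := fun s => v ∈ e s) i (hvert v)
    (fun ω => chainLoad_nonneg (hb0 ω) hr d _ v)
    (fun ω s => chainLoad_update r d (Finset.notMem_erase i H) (hb i hi) ω s v)

end Expectation

section Triples

variable {V : Type*} [Fintype V] [DecidableEq V]

theorem card_triples_pair_le {v a : V} (hva : v ≠ a) :
    (Finset.univ.filter fun s : {s : Finset V // s.card = 3} =>
      v ∈ (s : Finset V) ∧ a ∈ (s : Finset V)).card ≤ Fintype.card V := by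
  rw [← Finset.card_map (Function.Embedding.subtype _)]
  refine (Finset.card_le_card (t := Finset.univ.image fun y : V => {v, a, y}) ?_).trans
    Finset.card_image_le
  intro s hs
  obtain ⟨⟨hv, ha⟩, hs⟩ : (v ∈ s ∧ a ∈ s) ∧ s.card = 3 := by
    simpa [and_assoc] using hs
  have hsub : ({v, a} : Finset V) ⊆ s := by simp [Finset.insert_subset_iff, hv, ha]
  have hcard := Finset.card_sdiff_add_card_eq_card hsub
  rw [Finset.card_pair hva, hs] at hcard
  obtain ⟨y, hy⟩ := Finset.card_eq_one.1 (show (s \ {v, a}).card = 1 by omega)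
  refine Finset.mem_image.2 ⟨y, Finset.mem_univ _, ?_⟩
  have := Finset.sdiff_union_of_subset hsub
  rw [← this, hy]
  ext z; simp; tauto

theorem card_triples_vertex_le (v : V) :
    (Finset.univ.filter fun s : {s : Finset V // s.card = 3} => v ∈ (s : Finset V)).card ≤
      Fintype.card V * Fintype.card V := by
  refine (Finset.card_le_card (t := (Finset.univ.erase v).biUnion fun a => Finset.univ.filter
    fun s : {s : Finset V // s.card = 3} => v ∈ (s : Finset V) ∧ a ∈ (s : Finset V)) ?_).trans ?_
  · intro s hs
    have hv : v ∈ (s : Finset V) := by simpa using hs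
    obtain ⟨a, ha, hav⟩ := Finset.exists_mem_ne (by rw [s.2]; norm_num) v
    simp only [Finset.mem_biUnion, Finset.mem_filter, Finset.mem_erase, Finset.mem_univ, true_and,
      and_true]
    exact ⟨a, hav, hv, ha⟩
  · refine (Finset.card_biUnion_le_card_mul _ _ _ fun a ha =>
      card_triples_pair_le (Finset.ne_of_mem_erase ha).symm).trans ?_
    exact Nat.mul_le_mul_right _ (Finset.card_le_univ _)

end Triples

section Counting

/-- Markov's inequality for counting ratios. -/
theorem one_sub_le_card_filter_div_card {Ω : Type*} [Fintype Ω] [Nonempty Ω] {Y : Ω → ℝ}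
    {δ : ℝ} {P : Ω → Prop} [DecidablePred P] (hY : ∀ ω, 0 ≤ Y ω)
    (hsum : ∑ ω, Y ω ≤ δ * Fintype.card Ω) (hP : ∀ ω, Y ω < 1 → P ω) :
    1 - δ ≤ ((Finset.univ.filter P).card : ℝ) / Fintype.card Ω := by
  have hΩ : (0 : ℝ) < Fintype.card Ω := by exact_mod_cast Fintype.card_pos
  rw [le_div_iff₀ hΩ]
  have hbad : ((Finset.univ.filter fun ω => ¬ P ω).card : ℝ) ≤ ∑ ω, Y ω := by
    rw [← Finset.sum_boole]
    refine Finset.sum_le_sum fun ω _ => ?_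
    split_ifs with h
    · exact hY ω
    · exact le_of_not_gt fun hlt => h (hP ω hlt)
  have hsplit : ((Finset.univ.filter P).card : ℝ) + (Finset.univ.filter fun ω => ¬ P ω).card =
      Fintype.card Ω := by
    exact_mod_cast Finset.card_filter_add_card_filter_not P
  linarith

theorem cube_le_seven_mul_choose_three {N : ℕ} (hN : 100 ≤ N) :
    (N : ℝ) ^ 3 ≤ 7 * (N.choose 3 : ℝ) := by
  obtain ⟨M, rfl⟩ := Nat.exists_eq_add_of_le' (show 2 ≤ N by omega)
  have h : ((M + 2) * (M + 1) * M : ℝ) = 6 * ((M + 2).choose 3 : ℝ) := by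
    have := Nat.descFactorial_eq_factorial_mul_choose (M + 2) 3
    simp [Nat.descFactorial, Nat.factorial] at this
    exact_mod_cast (by rw [← this]; ring)
  have hM : (98 : ℝ) ≤ M := by exact_mod_cast (show 98 ≤ M by omega)
  push_cast
  nlinarith [mul_nonneg (sub_nonneg.2 hM) (sub_nonneg.2 hM), pow_nonneg (sub_nonneg.2 hM) 3]

end Counting

section Main

variable {n : ℕ} {V : Type*} [Fintype V] [DecidableEq V]

/-- If no chain of heavy edges returns to the edge it starts from, then the weight of the
non-peelable indices in `T` is bounded by chain loads and by the light indices of `T`. -/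
theorem sum_not_peelable_le {x : Fin n → ℝ} {es : Fin n → Finset V} {b : V → ℝ} {ρ τ : ℝ}
    {H T : Finset (Fin n)} (hb : ∀ v, 0 ≤ b v) (hρ : 0 ≤ ρ) (hes : ∀ j, 2 ≤ (es j).card)
    (hτ : ∀ i ∉ H, (x i) ^ 2 ≤ τ) (hτ0 : 0 ≤ τ) (hret : returnCount es n H < 1) :
    ∑ i ∈ T.filter (fun i => ¬ PeelableIdx x es b ρ H i), (x i) ^ 2 ≤
      ρ * ∑ i ∈ T ∩ H, ∑ v, (if v ∈ es i then chainLoad es b ρ n (H.erase i) v else 0) +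
        T.card * τ := by
  have hterm : ∀ i v, 0 ≤ if v ∈ es i then chainLoad es b ρ n (H.erase i) v else 0 := by
    intro i v
    split_ifs
    exacts [chainLoad_nonneg hb hρ _ _ _, le_rfl]
  have hsum : ∀ i, 0 ≤ ρ * ∑ v, if v ∈ es i then chainLoad es b ρ n (H.erase i) v else 0 :=
    fun i => mul_nonneg hρ (Finset.sum_nonneg fun v _ => hterm i v)
  obtain ⟨L, R, hL, hRH, hmem, hfree⟩ := exists_peelSeq_no_free x es b ρ H
  have hpt : ∀ i ∈ T.filter (fun i => ¬ PeelableIdx x es b ρ H i), (x i) ^ 2 ≤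
      (if i ∈ H then
        ρ * ∑ v, (if v ∈ es i then chainLoad es b ρ n (H.erase i) v else 0) else 0) + τ := by
    intro i hi
    split_ifs with hiH
    · have hiR : i ∈ R := by
        by_contra hiR
        exact (Finset.mem_filter.1 hi).2 ⟨L, hL, hmem i hiH hiR⟩
      obtain ⟨v, hv⟩ := Finset.card_pos.1 (lt_of_lt_of_le two_pos (hes i))
      have h := weight_le_chainLoad_erase (w := fun i => (x i) ^ 2) hb hρ
        (by simpa using Finset.card_le_univ H) hes hRH
        (fun j hj v hv => by
          have := hfree j hj
          simp only [IsFreeIdx, not_exists, not_and, not_le] at this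
          exact (this v hv).le)
        (fun i hi u hu v hv => chainStep_lt_one_of_returnCount_lt_one hret hi hu hv) hiR hv
      have h2 := Finset.single_le_sum (fun v _ => hterm i v) (Finset.mem_univ v)
      rw [if_pos hv] at h2
      linarith [mul_le_mul_of_nonneg_left h2 hρ]
    · linarith [hτ i hiH]
  refine (Finset.sum_le_sum hpt).trans ?_
  refine (Finset.sum_le_sum_of_subset_of_nonneg (Finset.filter_subset _ T) fun i _ _ => ?_).trans ?_
  · refine add_nonneg ?_ hτ0
    split_ifs
    exacts [hsum i, le_rfl]
  · rw [Finset.sum_add_distrib, Finset.sum_const, nsmul_eq_mul, Finset.mul_sum,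
      ← Finset.sum_filter, Finset.filter_mem_eq_inter]

end Main

theorem card_heavy_le {n k : ℕ} {ε : ℝ} {x : Fin n → ℝ} {T : Finset (Fin n)} (hk : 1 ≤ k)
    (hε : 0 < ε) (hε1 : ε ≤ 1) (hT : T.card = k) (htail : 0 < ∑ i ∈ Tᶜ, (x i) ^ 2) :
    ((Finset.univ.filter fun i => ε / (k : ℝ) * ∑ i ∈ Tᶜ, (x i) ^ 2 ≤ (x i) ^ 2).card : ℝ) ≤
      2 * (k / ε) := by
  set tail := ∑ i ∈ Tᶜ, (x i) ^ 2
  set H := Finset.univ.filter fun i => ε / (k : ℝ) * tail ≤ (x i) ^ 2 with hH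
  have hk0 : (0 : ℝ) < k := by exact_mod_cast hk
  have hin : (H ∩ T).card ≤ k := hT ▸ Finset.card_le_card Finset.inter_subset_right
  have hout : ((H \ T).card : ℝ) ≤ k / ε := by
    have h1 : ((H \ T).card : ℝ) * (ε / k * tail) ≤ tail := by
      rw [← nsmul_eq_mul]
      refine (Finset.card_nsmul_le_sum (H \ T) (fun i => (x i) ^ 2) _ fun i hi => ?_).trans
        (Finset.sum_le_sum_of_subset_of_nonneg ?_ fun i _ _ => sq_nonneg _)
      · simpa [hH] using (Finset.mem_sdiff.1 hi).1
      · intro i hi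
        exact Finset.mem_compl.2 (Finset.mem_sdiff.1 hi).2
    rw [← mul_assoc] at h1
    have h2 : ((H \ T).card : ℝ) * (ε / k) ≤ 1 := by
      by_contra hlt
      nlinarith
    rw [le_div_iff₀ hε]
    rw [← mul_div_assoc, div_le_one hk0] at h2
    exact h2
  have hsplit := Finset.card_inter_add_card_sdiff H T
  have hkε : (k : ℝ) ≤ k / ε := by
    rw [le_div_iff₀ hε]
    nlinarith
  have : (H.card : ℝ) = (H ∩ T).card + (H \ T).card := by exact_mod_cast hsplit.symm
  have hin' : ((H ∩ T).card : ℝ) ≤ k := by exact_mod_cast hin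
  linarith

theorem sum_light_le {n k : ℕ} {ε : ℝ} {x : Fin n → ℝ} {T : Finset (Fin n)} (hk : 1 ≤ k)
    (hε1 : ε ≤ 1) (hT : T.card = k) (htail : 0 < ∑ i ∈ Tᶜ, (x i) ^ 2) :
    ∑ i ∈ Finset.univ.filter (fun i => (x i) ^ 2 < ε / (k : ℝ) * ∑ i ∈ Tᶜ, (x i) ^ 2), (x i) ^ 2 ≤
      2 * ∑ i ∈ Tᶜ, (x i) ^ 2 := by
  set tail := ∑ i ∈ Tᶜ, (x i) ^ 2 with htaildef
  set L := Finset.univ.filter fun i => (x i) ^ 2 < ε / (k : ℝ) * tail with hL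
  have hk0 : (0 : ℝ) < k := by exact_mod_cast hk
  rw [← Finset.sum_inter_add_sum_sdiff L T]
  have hout : ∑ i ∈ L \ T, (x i) ^ 2 ≤ tail :=
    Finset.sum_le_sum_of_subset_of_nonneg
      (fun i hi => Finset.mem_compl.2 (Finset.mem_sdiff.1 hi).2) fun i _ _ => sq_nonneg _
  have hin : ∑ i ∈ L ∩ T, (x i) ^ 2 ≤ tail := by
    rcases (L ∩ T).eq_empty_or_nonempty with h | ⟨i₀, hi₀⟩
    · rw [h, Finset.sum_empty]
      exact htail.le
    have hmem : ∀ i ∈ L ∩ T, (x i) ^ 2 < ε / (k : ℝ) * tail := fun i hi => by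
      simpa [hL] using (Finset.mem_inter.1 hi).1
    have hτ : 0 ≤ ε / (k : ℝ) * tail := (sq_nonneg _).trans (hmem i₀ hi₀).le
    have h1 := Finset.sum_le_card_nsmul (L ∩ T) _ _ fun i hi => (hmem i hi).le
    rw [nsmul_eq_mul] at h1
    have h2 : ((L ∩ T).card : ℝ) ≤ k := by
      exact_mod_cast hT ▸ Finset.card_le_card Finset.inter_subset_right
    have h3 : (k : ℝ) * (ε / k * tail) = ε * tail := by field_simp
    nlinarith [mul_le_mul_of_nonneg_right h2 hτ]
  linarith

/-- The type of three-element sets of vertices. -/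
abbrev Triple (N : ℕ) : Type := {s : Finset (Fin N) // s.card = 3}

theorem le_density_mul_card_triple {N : ℕ} (hN : 100 ≤ N) :
    (N : ℝ) ≤ 7 / (N : ℝ) ^ 2 * Fintype.card (Triple N) := by
  have hN0 : (0 : ℝ) < N := by exact_mod_cast (show 0 < N by omega)
  rw [Fintype.card_finset_len, Fintype.card_fin, div_mul_eq_mul_div, le_div_iff₀ (by positivity)]
  linarith [cube_le_seven_mul_choose_three hN, show (N : ℝ) * N ^ 2 = N ^ 3 by ring]

theorem card_triple_pair_le_density {N : ℕ} (hN : 100 ≤ N) (v a : Fin N) (hva : v ≠ a) :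
    ((Finset.univ.filter fun s : Triple N => v ∈ s.1 ∧ a ∈ s.1).card : ℝ) ≤
      7 / (N : ℝ) ^ 2 * Fintype.card (Triple N) := by
  refine le_trans ?_ (le_density_mul_card_triple hN)
  have := card_triples_pair_le hva
  rw [Fintype.card_fin] at this
  exact_mod_cast this

theorem card_triple_vertex_le_density {N : ℕ} (hN : 100 ≤ N) (v : Fin N) :
    ((Finset.univ.filter fun s : Triple N => v ∈ s.1).card : ℝ) ≤
      7 / N * Fintype.card (Triple N) := by
  have hN0 : (0 : ℝ) < N := by exact_mod_cast (show 0 < N by omega)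
  have hNp : (N : ℝ) * (7 / (N : ℝ) ^ 2) = 7 / N := by field_simp
  rw [← hNp, mul_assoc]
  refine le_trans ?_ (mul_le_mul_of_nonneg_left (le_density_mul_card_triple hN) hN0.le)
  have := card_triples_vertex_le v
  rw [Fintype.card_fin] at this
  exact_mod_cast this

theorem nonempty_triple {N : ℕ} (hN : 100 ≤ N) : Nonempty (Triple N) := by
  refine Fintype.card_pos_iff.1 ?_
  rw [Fintype.card_finset_len, Fintype.card_fin]
  exact Nat.choose_pos (by omega)

/-- Total weight of the light edges through the vertex `v`. -/
noncomputable def vertexWeight {n N : ℕ} (x : Fin n → ℝ) (L : Finset (Fin n))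
    (ω : Fin n → Triple N) (v : Fin N) : ℝ :=
  ∑ j ∈ L.filter fun j => v ∈ (ω j).1, (x j) ^ 2

theorem vertexWeight_nonneg {n N : ℕ} (x : Fin n → ℝ) (L : Finset (Fin n)) (ω : Fin n → Triple N)
    (v : Fin N) : 0 ≤ vertexWeight x L ω v :=
  Finset.sum_nonneg fun _ _ => sq_nonneg _

theorem vertexWeight_update {n N : ℕ} (x : Fin n → ℝ) {L : Finset (Fin n)} {j : Fin n} (hj : j ∉ L)
    (ω : Fin n → Triple N) (s : Triple N) :
    vertexWeight x L (Function.update ω j s) = vertexWeight x L ω := by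
  funext v
  refine Finset.sum_congr (Finset.filter_congr fun i hi => ?_) fun _ _ => rfl
  rw [Function.update_of_ne (ne_of_mem_of_not_mem hi hj)]

theorem sum_vertexWeight {n N : ℕ} (x : Fin n → ℝ) (L : Finset (Fin n)) (ω : Fin n → Triple N) :
    ∑ v, vertexWeight x L ω v = 3 * ∑ j ∈ L, (x j) ^ 2 := by
  simp_rw [vertexWeight, Finset.sum_filter]
  rw [Finset.sum_comm, Finset.mul_sum]
  refine Finset.sum_congr rfl fun j _ => ?_
  simp [(ω j).2]

/-- Total chain load seen from the vertices of the edges with indices in `T ∩ H`. -/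
noncomputable def edgeLoad {n N : ℕ} (x : Fin n → ℝ) (T H L : Finset (Fin n))
    (ω : Fin n → Triple N) : ℝ :=
  ∑ i ∈ T ∩ H, ∑ v, if v ∈ (ω i).1 then
    chainLoad (fun j => (ω j).1) (vertexWeight x L ω) 2048 n (H.erase i) v else 0

theorem edgeLoad_nonneg {n N : ℕ} (x : Fin n → ℝ) (T H L : Finset (Fin n))
    (ω : Fin n → Triple N) : 0 ≤ edgeLoad x T H L ω := by
  refine Finset.sum_nonneg fun i _ => Finset.sum_nonneg fun v _ => ?_
  split_ifs
  exacts [chainLoad_nonneg (vertexWeight_nonneg x L ω) (by norm_num) _ _ _, le_rfl]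

theorem card_mul_density_le {n N : ℕ} {m : ℝ} {H : Finset (Fin n)} (hm1 : 1 ≤ m)
    (hNm : 2 ^ 19 * m ≤ (N : ℝ)) (hHcard : (H.card : ℝ) ≤ 2 * m) :
    2048 * ((Fintype.card (Fin N) : ℝ) * (7 / (N : ℝ) ^ 2 * H.card)) ≤ 1 / 2 := by
  have hN0 : (0 : ℝ) < N := by linarith
  have hload : (N : ℝ) * (7 / (N : ℝ) ^ 2 * H.card) = 7 * H.card / N := by field_simp
  rw [Fintype.card_fin, hload, ← mul_div_assoc, div_le_div_iff₀ hN0 two_pos]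
  linarith

theorem sum_edgeLoad_le {n k N : ℕ} {m τ : ℝ} {x : Fin n → ℝ} {T H L : Finset (Fin n)}
    (hm1 : 1 ≤ m) (hNm : 2 ^ 19 * m ≤ (N : ℝ)) (hT : T.card = k) (hHcard : (H.card : ℝ) ≤ 2 * m)
    (hLight : ∑ i ∈ L, (x i) ^ 2 ≤ 2 * (m * τ)) (hτ0 : 0 < τ) (hdisj : ∀ j ∈ H, j ∉ L) :
    ∑ ω : Fin n → Triple N, edgeLoad x T H L ω ≤
      k * τ / 2048 * Fintype.card (Fin n → Triple N) := by
  have hN0 : (0 : ℝ) < N := by linarith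
  have hN100 : 100 ≤ N := by
    have : (100 : ℝ) ≤ N := by linarith
    exact_mod_cast this
  have hmN : m / N ≤ 1 / 2 ^ 19 := by
    rw [div_le_div_iff₀ hN0 (by norm_num)]
    linarith
  have : Nonempty (Triple N) := nonempty_triple hN100
  have hq : (0 : ℝ) ≤ 7 / N := by positivity
  have hr : (0 : ℝ) ≤ 2048 := by norm_num
  have hp : (0 : ℝ) ≤ 7 / (N : ℝ) ^ 2 := by positivity
  have hedge : ∀ i ∈ T ∩ H, ∑ ω : Fin n → Triple N, ∑ v, (if v ∈ (ω i).1 then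
      chainLoad (fun j => (ω j).1) (vertexWeight x L ω) 2048 n (H.erase i) v else 0) ≤
      7 / N * (2 * ∑ ω : Fin n → Triple N, ∑ v, vertexWeight x L ω v) := fun i hi =>
    sum_sum_ite_chainLoad_le (e := fun s : Triple N => s.1) (card_triple_pair_le_density hN100)
      (card_triple_vertex_le_density hN100) hp hq hr (card_mul_density_le hm1 hNm hHcard)
      (vertexWeight_nonneg x L) (fun j hj => vertexWeight_update x (hdisj j hj)) n
      (Finset.mem_inter.1 hi).2
  simp only [edgeLoad]
  rw [Finset.sum_comm]
  refine (Finset.sum_le_card_nsmul _ _ _ hedge).trans ?_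
  simp only [sum_vertexWeight, Finset.sum_const, Finset.card_univ, nsmul_eq_mul]
  have hD0 : (0 : ℝ) ≤ Fintype.card (Fin n → Triple N) := Nat.cast_nonneg _
  generalize (Fintype.card (Fin n → Triple N) : ℝ) = D at hD0 ⊢
  have hcard : ((T ∩ H).card : ℝ) ≤ k := by
    exact_mod_cast hT ▸ Finset.card_le_card Finset.inter_subset_left
  have hΛ0 : 0 ≤ ∑ i ∈ L, (x i) ^ 2 := Finset.sum_nonneg fun _ _ => sq_nonneg _
  calc ((T ∩ H).card : ℝ) * (7 / N * (2 * (D * (3 * ∑ i ∈ L, (x i) ^ 2))))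
      ≤ k * (7 / N * (2 * (D * (3 * (2 * (m * τ)))))) := by gcongr
    _ = 84 * (m / N) * (k * τ * D) := by ring
    _ ≤ 84 * (1 / 2 ^ 19) * (k * τ * D) := by gcongr
    _ ≤ k * τ / 2048 * D := by nlinarith [mul_nonneg (mul_nonneg (Nat.cast_nonneg' k) hτ0.le) hD0]

/-- The conclusion for any set `H` of heavy and `L` of light indices whose number and total
weight, respectively, are small compared to the number `N` of vertices. -/
theorem peeling_probability {n k N : ℕ} {m τ : ℝ} {x : Fin n → ℝ} {T H L : Finset (Fin n)}
    (hk0 : (0 : ℝ) < k) (hm1 : 1 ≤ m) (hNm : 2 ^ 19 * m ≤ (N : ℝ)) (hT : T.card = k)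
    (hHcard : (H.card : ℝ) ≤ 2 * m) (hLight : ∑ i ∈ L, (x i) ^ 2 ≤ 2 * (m * τ)) (hτ0 : 0 < τ)
    (hHmem : ∀ i ∉ H, (x i) ^ 2 ≤ τ) (hdisj : ∀ j ∈ H, j ∉ L) :
    (0.97 : ℝ) ≤
      ((Finset.univ.filter fun ω : Fin n → Triple N =>
          ∑ i ∈ T.filter fun i =>
              ¬ PeelableIdx x (fun j => (ω j).1) (vertexWeight x L ω) 2048 H i,
            (x i) ^ 2
          ≤ 800 * (k * τ)).card : ℝ)
        / (Fintype.card (Fin n → Triple N) : ℝ) := by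
  have hN0 : (0 : ℝ) < N := by linarith
  have hN100 : 100 ≤ N := by
    have : (100 : ℝ) ≤ N := by linarith
    exact_mod_cast this
  have : Nonempty (Triple N) := nonempty_triple hN100
  have hX := sum_edgeLoad_le hm1 hNm hT hHcard hLight hτ0 hdisj
  have hsmall := card_mul_density_le hm1 hNm hHcard
  have hret := sum_returnCount_le (ι := Fin n) (H := H) (e := fun s : Triple N => s.1)
    (fun s => s.2) (card_triple_pair_le_density hN100) (by positivity) (by linarith) n
  have hret' : 18 * (7 / (N : ℝ) ^ 2) * (H.card : ℝ) ^ 2 ≤ 0.01 := by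
    have h : 18 * (7 / (N : ℝ) ^ 2) * (H.card : ℝ) ^ 2 = 126 * (H.card / N) ^ 2 := by
      field_simp
      ring
    have h0 : 0 ≤ (H.card : ℝ) / N := by positivity
    have hHN : (H.card : ℝ) / N ≤ 1 / 2 ^ 18 := by
      rw [div_le_div_iff₀ hN0 (by norm_num)]
      linarith
    rw [h]
    nlinarith
  have hD0 : (0 : ℝ) ≤ Fintype.card (Fin n → Triple N) := Nat.cast_nonneg _
  have hkτ0 : 0 < k * τ := mul_pos hk0 hτ0
  refine le_trans (by norm_num) (one_sub_le_card_filter_div_card (δ := 0.03)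
    (Y := fun ω : Fin n → Triple N => returnCount (fun i => (ω i).1) n H +
      2048 / (799 * (k * τ)) * edgeLoad x T H L ω) ?_ ?_ ?_)
  · exact fun ω => add_nonneg (returnCount_nonneg _ _ _)
      (mul_nonneg (by positivity) (edgeLoad_nonneg x T H L ω))
  · rw [Finset.sum_add_distrib, ← Finset.mul_sum]
    have h1 := mul_le_mul_of_nonneg_left hX (show 0 ≤ 2048 / (799 * (k * τ)) by positivity)
    have h2 : 2048 / (799 * (k * τ)) * (k * τ / 2048 * Fintype.card (Fin n → Triple N)) =
        Fintype.card (Fin n → Triple N) / 799 := by field_simp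
    have h3 := mul_le_mul_of_nonneg_right hret' hD0
    linarith
  · intro ω hω
    have hload : 0 ≤ 2048 / (799 * (k * τ)) * edgeLoad x T H L ω :=
      mul_nonneg (by positivity) (edgeLoad_nonneg x T H L ω)
    have hret0 := returnCount_nonneg (fun i => (ω i).1) n H
    refine (sum_not_peelable_le (τ := τ) (vertexWeight_nonneg x L ω) (by norm_num)
      (fun j => by simp [(ω j).2]) hHmem hτ0.le (by linarith)).trans ?_
    have h1 : 2048 / (799 * (k * τ)) * edgeLoad x T H L ω < 1 := by linarith
    rw [div_mul_eq_mul_div, div_lt_one (by positivity)] at h1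
    rw [hT, ← edgeLoad]
    linarith

/-- Weight of non-peelable edges. There is a constant `C₀` such that
for all instances with `k/ε ≥ C₀`: hash each coordinate `i ∈ [n]` to an independent
uniformly random 3-element subset `e_i` of `V = [2¹⁹·c·k/ε]`, form the associated
3-uniform weighted hypergraph with edges `{e_i : i ∈ H}` (`H` the heavy coordinates),
edge weights `x_i²` and vertex weights `w_v = ∑_{i ∈ L, v ∈ e_i} x_i²` (`L` the light
coordinates), and let `P` be the set of `i ∈ H` with `e_i` `2048`-peelable. Then with
probability at least `0.97` (a counting ratio over the uniform sample space),
`‖x_{T∖P}‖₂² ≤ 800·ε·‖x_{−k}‖₂²`, where `T` is the set of the `k` largest coordinates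
of `x` in absolute value and `‖x_{−k}‖₂² = ∑_{i ∉ T} x_i²`. -/
theorem stmt_11 :
    ∃ C0 : ℝ, ∀ (n k c : ℕ) (ε : ℝ) (x : Fin n → ℝ) (T : Finset (Fin n)),
      1 ≤ k → 1 ≤ c → k ≤ n → 0 < ε → ε ≤ 1 →
      T.card = k →
      (∀ i ∈ T, ∀ j, j ∉ T → |x j| ≤ |x i|) →
      (0 < ∑ i ∈ Tᶜ, (x i) ^ 2) →
      C0 ≤ (k : ℝ) / ε →
      (let tail : ℝ := ∑ i ∈ Tᶜ, (x i) ^ 2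
       let N : ℕ := ⌈(2 ^ 19 * (c : ℝ) * k) / ε⌉₊
       let H : Finset (Fin n) := Finset.univ.filter fun i => ε / (k : ℝ) * tail ≤ (x i) ^ 2
       let Lset : Finset (Fin n) := Finset.univ.filter fun i => (x i) ^ 2 < ε / (k : ℝ) * tail
       (0.97 : ℝ) ≤
        ((Finset.univ.filter fun ω : Fin n → {s : Finset (Fin N) // s.card = 3} =>
            ∑ i ∈ T.filter fun i =>
                ¬ PeelableIdx x (fun j => (ω j : Finset (Fin N)))
                    (fun v => ∑ j ∈ Lset.filter fun j => v ∈ (ω j : Finset (Fin N)), (x j) ^ 2)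
                    2048 H i,
              (x i) ^ 2
            ≤ 800 * ε * tail).card : ℝ)
          / (Fintype.card (Fin n → {s : Finset (Fin N) // s.card = 3}) : ℝ)) := by
  refine ⟨0, ?_⟩
  intro n k c ε x T hk hc _ hε hε1 hT _ htail _ tail N H Lset
  have hk0 : (0 : ℝ) < k := by exact_mod_cast hk
  have hc1 : (1 : ℝ) ≤ c := by exact_mod_cast hc
  have hm1 : 1 ≤ (k : ℝ) / ε := by
    rw [le_div_iff₀ hε]
    have : (1 : ℝ) ≤ k := by exact_mod_cast hk
    linarith
  set m : ℝ := (k : ℝ) / ε with hm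
  have hNm : 2 ^ 19 * m ≤ (N : ℝ) := by
    refine le_trans ?_ (Nat.le_ceil _)
    rw [mul_div_assoc, mul_assoc]
    nlinarith
  have hHcard : (H.card : ℝ) ≤ 2 * m := card_heavy_le hk hε hε1 hT htail
  have hLight : ∑ i ∈ Lset, (x i) ^ 2 ≤ 2 * tail := sum_light_le hk hε1 hT htail
  set τ : ℝ := ε / (k : ℝ) * tail with hτ
  have hτ0 : 0 < τ := by positivity
  have htailτ : tail = m * τ := by rw [hm, hτ]; field_simp
  have hkτ : ε * tail = k * τ := by rw [hτ]; field_simp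
  have hHmem : ∀ i ∉ H, (x i) ^ 2 ≤ τ := fun i hi =>
    (not_le.1 fun h => hi (Finset.mem_filter.2 ⟨Finset.mem_univ i, h⟩)).le
  have hdisj : ∀ j ∈ H, j ∉ Lset := fun j hj hjL =>
    absurd (Finset.mem_filter.1 hj).2 (not_le.2 (Finset.mem_filter.1 hjL).2)
  rw [htailτ] at hLight
  simp only [mul_assoc, hkτ]
  exact peeling_probability hk0 hm1 hNm hT hHcard hLight hτ0 hHmem hdisj
end

section
/- Let x, x̂ ∈ ℝ^n, let k ≥ 1 be an integer with 3k ≤ n, and let 0 < ε ≤ 1. Suppose that |x_i − x̂_i|² ≤ (ε/k)·‖x_{−k}‖₂² for all i ∈ [n], and let T ⊆ [n] be the set of the k largest coordinates of x in absolute value. Let R ⊆ [n] be any set satisfying ‖x_{T \ R}‖₂² ≤ 800·ε·‖x_{−k}‖₂². Let S ⊆ R consist of the min(3k, |R|) indices i ∈ R with largest |x̂_i| (breaking ties arbitrarily), and set x' = x̂_S. Then ‖x − x'‖₂² ≤ (1 + 900·ε)·‖x_{−k}‖₂². -/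
/-- If two estimates `u`, `v` of `a`, `b` have squared error at most `D` and `|u| ≤ |v|`, then
`a ^ 2` exceeds `2 * b ^ 2` by at most `9 * D`. -/
lemma sq_le_two_mul_sq_add_of_abs_le {a b u v D : ℝ} (ha : (a - u) ^ 2 ≤ D)
    (hb : (b - v) ^ 2 ≤ D) (huv : |u| ≤ |v|) : a ^ 2 ≤ 2 * b ^ 2 + 9 * D := by
  have h1 : u ^ 2 ≤ v ^ 2 := sq_le_sq.mpr huv
  have h2 : a ^ 2 ≤ 7 / 5 * u ^ 2 + 7 / 2 * (a - u) ^ 2 := by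
    nlinarith [sq_nonneg (2 * u - 5 * (a - u))]
  have h3 : v ^ 2 ≤ 7 / 5 * b ^ 2 + 7 / 2 * (b - v) ^ 2 := by
    nlinarith [sq_nonneg (2 * b + 5 * (b - v))]
  nlinarith [sq_nonneg b, sq_nonneg (a - u)]

/-- If `f ≤ 2 * g + D` pairwise between `A` and `B`, where `|A| ≤ k` and `2 * k ≤ |B|`, then
the sum of `f` over `A` exceeds the sum of `g` over `B` by at most `k * D`. -/
lemma sum_le_sum_add_of_pairwise_le {ι : Type*} {A B : Finset ι} {f g : ι → ℝ} {k : ℕ} {D : ℝ}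
    (hk : 1 ≤ k) (hD : 0 ≤ D) (hg : ∀ j, 0 ≤ g j) (hA : A.card ≤ k) (hB : 2 * k ≤ B.card)
    (h : ∀ i ∈ A, ∀ j ∈ B, f i ≤ 2 * g j + D) :
    ∑ i ∈ A, f i ≤ ∑ j ∈ B, g j + k * D := by
  obtain ⟨j, hj, hmin⟩ := B.exists_min_image g (Finset.card_pos.mp (by omega))
  have hsumA : ∑ i ∈ A, f i ≤ A.card * (2 * g j + D) := by
    simpa only [nsmul_eq_mul] using Finset.sum_le_card_nsmul A f _ fun i hi => h i hi j hj
  have hsumB : B.card * g j ≤ ∑ j ∈ B, g j := by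
    simpa using Finset.card_nsmul_le_sum B g _ hmin
  have hA' : (A.card : ℝ) * (2 * g j + D) ≤ k * (2 * g j + D) :=
    mul_le_mul_of_nonneg_right (by exact_mod_cast hA) (by linarith [hg j])
  have hB' : (2 * k : ℝ) * g j ≤ B.card * g j :=
    mul_le_mul_of_nonneg_right (by exact_mod_cast hB) (hg j)
  linarith

/-- Refinement. Let `T` be the set of the `k` largest coordinates of
`x` in absolute value (so `‖x_{−k}‖₂² = ∑_{i ∉ T} x_i²`), suppose
`|x_i − x̂_i|² ≤ (ε/k)·‖x_{−k}‖₂²` for all `i`, and let `R` satisfy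
`‖x_{T∖R}‖₂² ≤ 800·ε·‖x_{−k}‖₂²`. If `S ⊆ R` consists of `min(3k, |R|)` indices of `R`
with largest `|x̂_i|`, and `x' = x̂_S`, then `‖x − x'‖₂² ≤ (1 + 900·ε)·‖x_{−k}‖₂²`. -/
theorem stmt_12 (n k : ℕ) (hk : 1 ≤ k) (h3k : 3 * k ≤ n)
    (ε : ℝ) (hε0 : 0 < ε) (hε1 : ε ≤ 1)
    (x xh : Fin n → ℝ)
    (T : Finset (Fin n)) (hT : T.card = k)
    (hTtop : ∀ i ∈ T, ∀ j, j ∉ T → |x j| ≤ |x i|)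
    (hpt : ∀ i : Fin n, (x i - xh i) ^ 2 ≤ ε / (k : ℝ) * ∑ i' ∈ Tᶜ, (x i') ^ 2)
    (R S : Finset (Fin n))
    (hRT : ∑ i ∈ T \ R, (x i) ^ 2 ≤ 800 * ε * ∑ i' ∈ Tᶜ, (x i') ^ 2)
    (hSR : S ⊆ R) (hScard : S.card = min (3 * k) R.card)
    (hSsel : ∀ i ∈ R, i ∉ S → ∀ j ∈ S, |xh i| ≤ |xh j|) :
    ∑ i, (x i - (if i ∈ S then xh i else 0)) ^ 2
      ≤ (1 + 900 * ε) * ∑ i ∈ Tᶜ, (x i) ^ 2 := by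
  set E := ∑ i ∈ Tᶜ, (x i) ^ 2 with hE
  have hE0 : 0 ≤ E := Finset.sum_nonneg fun i _ => sq_nonneg _
  have hk0 : (0 : ℝ) < k := by exact_mod_cast hk
  set D := ε / (k : ℝ) * E with hD
  have hD0 : 0 ≤ D := by positivity
  have hkD : (k : ℝ) * D = ε * E := by rw [hD]; field_simp
  have hsplit : ∑ i, (x i - (if i ∈ S then xh i else 0)) ^ 2
      = ∑ i ∈ S, (x i - xh i) ^ 2 + ∑ i ∈ Sᶜ, (x i) ^ 2 := by
    rw [← Finset.sum_add_sum_compl S]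
    congr 1
    · exact Finset.sum_congr rfl fun i hi => by rw [if_pos hi]
    · exact Finset.sum_congr rfl fun i hi => by
        rw [if_neg (Finset.mem_compl.mp hi), sub_zero]
  have hS : ∑ i ∈ S, (x i - xh i) ^ 2 ≤ 3 * (ε * E) := by
    have h1 : ∑ i ∈ S, (x i - xh i) ^ 2 ≤ S.card * D := by
      simpa using Finset.sum_le_card_nsmul S _ _ fun i _ => hpt i
    have h2 : (S.card : ℝ) ≤ 3 * k := by
      exact_mod_cast hScard.trans_le (min_le_left _ _)
    nlinarith [mul_le_mul_of_nonneg_right h2 hD0]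
  have hcompl : ∑ i ∈ Sᶜ, (x i) ^ 2 + ∑ i ∈ S \ T, (x i) ^ 2
      = ∑ i ∈ T \ R, (x i) ^ 2 + ∑ i ∈ (T ∩ R) \ S, (x i) ^ 2 + E := by
    have hsum (U : Finset (Fin n)) :
        ∑ i ∈ U, (x i) ^ 2 = ∑ i, if i ∈ U then (x i) ^ 2 else 0 := by simp
    rw [hE]
    simp only [hsum, ← Finset.sum_add_distrib]
    refine Finset.sum_congr rfl fun i _ => ?_
    have hi : i ∈ S → i ∈ R := fun h => hSR h
    by_cases h1 : i ∈ S <;> by_cases h2 : i ∈ T <;> by_cases h3 : i ∈ R <;> simp_all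
  have hmissed : ∑ i ∈ (T ∩ R) \ S, (x i) ^ 2 ≤ ∑ i ∈ S \ T, (x i) ^ 2 + 9 * (ε * E) := by
    rcases le_total R.card (3 * k) with hR | hR
    · have hSR' : S = R := Finset.eq_of_subset_of_card_le hSR (by omega)
      have hempty : (T ∩ R) \ S = ∅ := by
        rw [hSR', Finset.sdiff_eq_empty_iff_subset]
        exact Finset.inter_subset_right
      rw [hempty, Finset.sum_empty]
      have := Finset.sum_nonneg fun i (_ : i ∈ S \ T) => sq_nonneg (x i)
      positivity
    · have hA : ((T ∩ R) \ S).card ≤ k := hT ▸ Finset.card_le_card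
        (Finset.sdiff_subset.trans Finset.inter_subset_left)
      have hB : 2 * k ≤ (S \ T).card := by
        have := Finset.le_card_sdiff T S
        omega
      have := sum_le_sum_add_of_pairwise_le (f := fun i => x i ^ 2) (g := fun i => x i ^ 2)
        (D := 9 * D) hk (by positivity) (fun j => sq_nonneg (x j)) hA hB fun i hi j hj => by
          simp only [Finset.mem_sdiff, Finset.mem_inter] at hi hj
          exact sq_le_two_mul_sq_add_of_abs_le (hpt i) (hpt j) (hSsel i hi.1.2 hi.2 j hj.1)
      linarith
  have : 0 ≤ ε * E := by positivity
  linarith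
end
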